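/- Let p be a prime, f ≥ 1, q = p^f. In 𝔽_q[X_0,Y_0,…,X_{f−1},Y_{f−1}] let θ_k = X_k·Y_{k−1}^p − Y_k·X_{k−1}^p for 1 ≤ k ≤ f−1. For 0 ≤ j ≤ f−1 let c_j, d_j, g_j, h_j be natural numbers with c_j + d_j = r_j = g_j + h_j and r_j ≥ p^{f−j}. If Σ_{j=0}^{f−1} d_j p^j = Σ_{j=0}^{f−1} h_j p^j, then the polynomial P = ∏_{j=0}^{f−1} X_j^{c_j}Y_j^{d_j} − ∏_{j=0}^{f−1} X_j^{g_j}Y_j^{h_j} lies in the ideal of 𝔽_q[X_0,Y_0,…,X_{f−1},Y_{f−1}] generated by θ_1, …, θ_{f−1}. -/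

import Mathlib

open MvPolynomial

/-- The twisted Dickson polynomial `θ_k = X_k·Y_{k−1}^p − Y_k·X_{k−1}^p`
(indices mod `f`), in `𝔽_q[X_0,Y_0,…,X_{f−1},Y_{f−1}]` with `X_j = X (j,0)`,
`Y_j = X (j,1)`. Only `θ_k` for `k ≠ 0` are used below. -/
noncomputable def thetaTw (p f : ℕ) [Fact p.Prime] [NeZero f] (k : Fin f) :
    MvPolynomial (Fin f × Fin 2) (GaloisField p f) :=
  X (k, 0) * X (k - 1, 1) ^ p - X (k, 1) * X (k - 1, 0) ^ p

/-- The monomial `∏_{j < n} x_j^{r_j - d_j} y_j^{d_j}` of multidegree `r` and `y`-degrees `d`. -/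
def bihomMonomial {M : Type*} [CommMonoid M] (x y : ℕ → M) (r : ℕ → ℕ) (n : ℕ) (d : ℕ → ℕ) : M :=
  ∏ j ∈ Finset.range n, x j ^ (r j - d j) * y j ^ d j

/-- Carry one unit in base `p` from digit `k` to digit `k + 1`. -/
def carryDigit (p k : ℕ) (d : ℕ → ℕ) : ℕ → ℕ :=
  Function.update (Function.update d k (d k - p)) (k + 1) (d (k + 1) + 1)

section carryDigit

variable {p k : ℕ} {d r : ℕ → ℕ}

@[simp] lemma carryDigit_self : carryDigit p k d k = d k - p := by
  simp [carryDigit]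

@[simp] lemma carryDigit_succ : carryDigit p k d (k + 1) = d (k + 1) + 1 := by
  simp [carryDigit]

lemma carryDigit_of_ne {j : ℕ} (h₁ : j ≠ k) (h₂ : j ≠ k + 1) : carryDigit p k d j = d j := by
  simp [carryDigit, h₁, h₂]

lemma carryDigit_le (hd : ∀ j, d j ≤ r j) (hlt : d (k + 1) < r (k + 1)) (j : ℕ) :
    carryDigit p k d j ≤ r j := by
  rcases eq_or_ne j (k + 1) with rfl | h₂
  · simpa using hlt
  rcases eq_or_ne j k with rfl | h₁
  · simpa using (hd j).trans (Nat.le_add_right _ _)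
  · simpa [carryDigit_of_ne h₁ h₂] using hd j

lemma sum_carryDigit (hp : p ≤ d k) :
    ∑ j ∈ Finset.range (k + 2), carryDigit p k d j * p ^ j =
      ∑ j ∈ Finset.range (k + 2), d j * p ^ j := by
  have hlow : ∑ j ∈ Finset.range k, carryDigit p k d j * p ^ j =
      ∑ j ∈ Finset.range k, d j * p ^ j :=
    Finset.sum_congr rfl fun j hj => by
      rw [Finset.mem_range] at hj
      rw [carryDigit_of_ne (by omega) (by omega)]
  obtain ⟨m, hm⟩ := Nat.exists_eq_add_of_le hp
  simp only [Finset.sum_range_succ, hlow, carryDigit_self, carryDigit_succ, hm,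
    Nat.add_sub_cancel_left]
  ring

end carryDigit

section bihomMonomial

variable {M : Type*} [CommMonoid M] {x y : ℕ → M} {p n : ℕ} {r : ℕ → ℕ}

lemma bihomMonomial_carryDigit
    (hrel : ∀ k, k + 1 < n → x (k + 1) * y k ^ p = y (k + 1) * x k ^ p)
    {k : ℕ} {d : ℕ → ℕ} (hk : k + 1 < n) (hp : p ≤ d k) (hd : d k ≤ r k)
    (hlt : d (k + 1) < r (k + 1)) :
    bihomMonomial x y r n (carryDigit p k d) = bihomMonomial x y r n d := by
  have hk₁ : k + 1 ∈ Finset.range n := by simpa using hk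
  have hk₀ : k ∈ (Finset.range n).erase (k + 1) := by simp; omega
  unfold bihomMonomial
  rw [← Finset.mul_prod_erase _ _ hk₁, ← Finset.mul_prod_erase _ _ hk₀,
    ← Finset.mul_prod_erase (Finset.range n) _ hk₁, ← Finset.mul_prod_erase _ _ hk₀]
  conv_lhs => rw [← mul_assoc]
  conv_rhs => rw [← mul_assoc]
  congr 1
  · obtain ⟨a, ha⟩ := Nat.exists_eq_add_of_le hp
    obtain ⟨b, hb⟩ := Nat.exists_eq_add_of_le hd
    obtain ⟨e, he⟩ := Nat.exists_eq_add_of_lt hlt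
    have h₁ : r k - (d k - p) = b + p := by omega
    have h₂ : r k - d k = b := by omega
    have h₃ : r (k + 1) - (d (k + 1) + 1) = e := by omega
    have h₄ : r (k + 1) - d (k + 1) = e + 1 := by omega
    have h₅ : d k - p = a := by omega
    rw [carryDigit_self, carryDigit_succ, h₁, h₂, h₃, h₄, h₅, ha]
    calc x (k + 1) ^ e * y (k + 1) ^ (d (k + 1) + 1) * (x k ^ (b + p) * y k ^ a)
        = (x (k + 1) ^ e * y (k + 1) ^ d (k + 1) * x k ^ b * y k ^ a) *
            (y (k + 1) * x k ^ p) := by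
          simp only [pow_add, pow_one]; ac_rfl
      _ = (x (k + 1) ^ e * y (k + 1) ^ d (k + 1) * x k ^ b * y k ^ a) *
            (x (k + 1) * y k ^ p) := by rw [hrel k hk]
      _ = x (k + 1) ^ (e + 1) * y (k + 1) ^ d (k + 1) * (x k ^ b * y k ^ (p + a)) := by
          simp only [pow_add, pow_one]; ac_rfl
  · refine Finset.prod_congr rfl fun j hj => ?_
    simp only [Finset.mem_erase] at hj
    rw [carryDigit_of_ne hj.1 hj.2.1]

/-- If the digits `0, …, k` of `d` have total weight at least `p ^ (k + 1)`, then carrying from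
lower digits makes digit `k` at least `p`, without changing the monomial. -/
lemma exists_bihomMonomial_eq_and_le
    (hrel : ∀ k, k + 1 < n → x (k + 1) * y k ^ p = y (k + 1) * x k ^ p)
    (hr : ∀ j < n, p ≤ r j) (k : ℕ) (hk : k < n) (d : ℕ → ℕ) (hd : ∀ j, d j ≤ r j)
    (hw : p ^ (k + 1) ≤ ∑ j ∈ Finset.range (k + 1), d j * p ^ j) :
    ∃ e : ℕ → ℕ, bihomMonomial x y r n e = bihomMonomial x y r n d ∧ p ≤ e k ∧
      (∀ j, k < j → e j = d j) ∧ (∀ j, e j ≤ r j) ∧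
      ∑ j ∈ Finset.range (k + 1), e j * p ^ j = ∑ j ∈ Finset.range (k + 1), d j * p ^ j := by
  induction k generalizing d with
  | zero => exact ⟨d, rfl, by simpa using hw, fun _ _ => rfl, hd, rfl⟩
  | succ k ih =>
    obtain ⟨m, hm⟩ : ∃ m, p ≤ d (k + 1) + m := ⟨p, Nat.le_add_left _ _⟩
    induction m generalizing d with
    | zero => exact ⟨d, rfl, hm, fun _ _ => rfl, hd, rfl⟩
    | succ m ihm =>
      by_cases hle : p ≤ d (k + 1)
      · exact ⟨d, rfl, hle, fun _ _ => rfl, hd, rfl⟩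
      have hlow : p ^ (k + 1) ≤ ∑ j ∈ Finset.range (k + 1), d j * p ^ j := by
        rw [Finset.sum_range_succ] at hw
        have : (d (k + 1) + 1) * p ^ (k + 1) ≤ p * p ^ (k + 1) :=
          Nat.mul_le_mul_right _ (by omega)
        rw [pow_succ' p (k + 1)] at hw
        linarith
      obtain ⟨e, hed, hpe, he, her, hes⟩ := ih (by omega) d hd hlow
      have he₁ : e (k + 1) = d (k + 1) := he _ (by omega)
      have hlt : e (k + 1) < r (k + 1) := by have := hr _ hk; omega
      have hsum : ∑ j ∈ Finset.range (k + 2), carryDigit p k e j * p ^ j =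
          ∑ j ∈ Finset.range (k + 2), d j * p ^ j := by
        rw [sum_carryDigit hpe, Finset.sum_range_succ, hes, he₁, ← Finset.sum_range_succ]
      obtain ⟨e', h₁, h₂, h₃, h₄, h₅⟩ := ihm (carryDigit p k e) (carryDigit_le her hlt)
        (hsum ▸ hw) (by rw [carryDigit_succ]; omega)
      refine ⟨e', ?_, h₂, fun j hj => ?_, h₄, h₅.trans hsum⟩
      · rw [h₁, bihomMonomial_carryDigit hrel hk hpe (her k) hlt, hed]
      · rw [h₃ j hj, carryDigit_of_ne (by omega) (by omega), he j (by omega)]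

/-- Two monomials of the same multidegree and the same `p`-adic weight agree as soon as
`x_{k+1} y_k ^ p = y_{k+1} x_k ^ p` for all `k`. -/
lemma bihomMonomial_eq_of_sum_eq
    (hrel : ∀ k, k + 1 < n → x (k + 1) * y k ^ p = y (k + 1) * x k ^ p)
    (hr : ∀ j < n, p ≤ r j) (k : ℕ) (hk : k ≤ n) (d h : ℕ → ℕ)
    (hd : ∀ j, d j ≤ r j) (hh : ∀ j, h j ≤ r j) (heq : ∀ j, k ≤ j → j < n → d j = h j)
    (hsum : ∑ j ∈ Finset.range k, d j * p ^ j = ∑ j ∈ Finset.range k, h j * p ^ j) :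
    bihomMonomial x y r n d = bihomMonomial x y r n h := by
  induction k generalizing d h with
  | zero =>
    exact Finset.prod_congr rfl fun j hj => by
      rw [heq j (Nat.zero_le j) (Finset.mem_range.mp hj)]
  | succ k ih =>
    wlog hle : d k ≤ h k generalizing d h
    · exact (this h d hh hd (fun j hj hjn => (heq j hj hjn).symm) hsum.symm (by omega)).symm
    obtain ⟨m, hm⟩ := Nat.exists_eq_add_of_le hle
    clear hle
    induction m generalizing d with
    | zero =>
      refine ih (by omega) d h hd hh (fun j hj hjn => ?_) ?_
      · rcases hj.eq_or_lt with rfl | hj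
        · exact hm.symm
        · exact heq j hj hjn
      · rw [Finset.sum_range_succ, Finset.sum_range_succ, hm] at hsum
        simpa using hsum
    | succ m ihm =>
      have hlow : p ^ k ≤ ∑ j ∈ Finset.range k, d j * p ^ j := by
        rw [Finset.sum_range_succ, Finset.sum_range_succ, hm] at hsum
        have : (d k + 1) * p ^ k ≤ (d k + (m + 1)) * p ^ k := Nat.mul_le_mul_right _ (by omega)
        linarith [Nat.zero_le (∑ j ∈ Finset.range k, h j * p ^ j)]
      cases k with
      | zero => simp at hlow
      | succ k =>
        obtain ⟨e, hed, hpe, he, her, hes⟩ :=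
          exists_bihomMonomial_eq_and_le hrel hr k (by omega) d hd hlow
        have he₁ : e (k + 1) = d (k + 1) := he _ (by omega)
        have hlt : e (k + 1) < r (k + 1) := by have := hh (k + 1); omega
        rw [← hed, ← bihomMonomial_carryDigit hrel (by omega) hpe (her k) hlt]
        refine ihm _ (carryDigit_le her hlt) (fun j hj hjn => ?_) ?_ ?_
        · rw [carryDigit_of_ne (by omega) (by omega), he j (by omega), heq j hj hjn]
        · rw [sum_carryDigit hpe, Finset.sum_range_succ, hes, he₁, ← Finset.sum_range_succ, hsum]
        · rw [carryDigit_succ]; omega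

end bihomMonomial

/-- a difference of monomials of the same multidegree `(r_0,…,r_{f−1})`
(with `r_j ≥ p^{f−j}`) whose `Y`-weights `Σ d_j p^j` and `Σ h_j p^j` are equal lies in
the ideal generated by `θ_1, …, θ_{f−1}`. -/
theorem monomial_difference_mem_span (p f : ℕ) [Fact p.Prime] [NeZero f]
    (c d g h r : Fin f → ℕ)
    (hcd : ∀ j, c j + d j = r j) (hgh : ∀ j, g j + h j = r j)
    (hr : ∀ j : Fin f, p ^ (f - (j : ℕ)) ≤ r j)
    (hsum : ∑ j : Fin f, d j * p ^ (j : ℕ) = ∑ j : Fin f, h j * p ^ (j : ℕ)) :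
    ((∏ j : Fin f, X (j, 0) ^ c j * X (j, 1) ^ d j :
          MvPolynomial (Fin f × Fin 2) (GaloisField p f)) -
        ∏ j : Fin f, X (j, 0) ^ g j * X (j, 1) ^ h j) ∈
      Ideal.span (thetaTw p f '' {k : Fin f | k ≠ 0}) := by
  set I := Ideal.span (thetaTw p f '' {k : Fin f | k ≠ 0})
  let π := Ideal.Quotient.mk I
  let x : ℕ → MvPolynomial (Fin f × Fin 2) (GaloisField p f) ⧸ I := fun j =>
    π (X (Fin.ofNat f j, 0))
  let y : ℕ → MvPolynomial (Fin f × Fin 2) (GaloisField p f) ⧸ I := fun j =>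
    π (X (Fin.ofNat f j, 1))
  have hrel : ∀ k, k + 1 < f → x (k + 1) * y k ^ p = y (k + 1) * x k ^ p := by
    intro k hk
    have hsub : Fin.ofNat f (k + 1) - 1 = Fin.ofNat f k := by
      rw [sub_eq_iff_eq_add]
      ext
      simp [Fin.val_add]
    have hne : Fin.ofNat f (k + 1) ≠ 0 := by
      intro h0
      have := congrArg Fin.val h0
      simp [Nat.mod_eq_of_lt hk] at this
    have hmem : thetaTw p f (Fin.ofNat f (k + 1)) ∈ I :=
      Ideal.subset_span ⟨_, hne, rfl⟩
    rw [thetaTw, hsub] at hmem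
    simpa [x, y, π] using Ideal.Quotient.eq.mpr hmem
  have hmon : ∀ a b : Fin f → ℕ, (∀ j, a j + b j = r j) →
      π (∏ j : Fin f, X (j, 0) ^ a j * X (j, 1) ^ b j) =
        bihomMonomial x y (fun j => r (Fin.ofNat f j)) f (fun j => b (Fin.ofNat f j)) := by
    intro a b hab
    rw [bihomMonomial, ← Fin.prod_univ_eq_prod_range
      (fun j => x j ^ (r (Fin.ofNat f j) - b (Fin.ofNat f j)) * y j ^ b (Fin.ofNat f j)), map_prod]
    refine Finset.prod_congr rfl fun j _ => ?_
    have haj : r j - b j = a j := by have := hab j; omega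
    simp [x, y, haj]
  have hsum' : ∀ b : Fin f → ℕ, ∑ j ∈ Finset.range f, b (Fin.ofNat f j) * p ^ j =
      ∑ j : Fin f, b j * p ^ (j : ℕ) := by
    intro b
    rw [← Fin.sum_univ_eq_sum_range (fun j => b (Fin.ofNat f j) * p ^ j)]
    simp
  rw [← Ideal.Quotient.eq]
  change π _ = π _
  rw [hmon c d hcd, hmon g h hgh]
  refine bihomMonomial_eq_of_sum_eq hrel (fun j hj => ?_) f le_rfl _ _
    (fun j => by have := hcd (Fin.ofNat f j); omega)
    (fun j => by have := hgh (Fin.ofNat f j); omega) (fun j hj hjf => absurd hjf hj.not_gt) ?_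
  · refine le_trans ?_ (hr (Fin.ofNat f j))
    exact Nat.le_self_pow (by simp only [Fin.val_ofNat, Nat.mod_eq_of_lt hj]; omega) p
  · rw [hsum', hsum', hsum]
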